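/- arXiv:2003.04475 — 7 statements merged into one kernel-verified Lean document; each statement's English description precedes it below -/
import Mathlib

section
/- Let D_S and D_T be source and target domains (probability measures on 𝒳 × 𝒴 with 𝒴 = Fin k), let φ : 𝒳 → 𝒵̃ and l : 𝒵̃ → 𝒴 be measurable maps, and set Ŷ = l(φ(X)). Let D_S^Z̃, D_T^Z̃ denote the pushforwards of the input marginals D_S^X, D_T^X under φ, and D_S^Y, D_T^Y the label marginals. If D_JS(D_S^Y ‖ D_T^Y) ≥ D_JS(D_S^Z̃ ‖ D_T^Z̃), then ε_S(l∘φ) + ε_T(l∘φ) ≥ (1/2)·(√(D_JS(D_S^Y ‖ D_T^Y)) − √(D_JS(D_S^Z̃ ‖ D_T^Z̃)))². -/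
open MeasureTheory Real
open scoped ENNReal

/-- Kullback–Leibler divergence (real-valued, via the Radon–Nikodym derivative). -/
noncomputable def klDiv {Ω : Type*} [MeasurableSpace Ω] (μ ν : Measure Ω) : ℝ :=
  ∫ x, Real.log ((μ.rnDeriv ν) x).toReal ∂μ

/-- Jensen–Shannon divergence: `(1/2)·KL(μ‖M) + (1/2)·KL(ν‖M)` with `M = (μ+ν)/2`. -/
noncomputable def jsDiv {Ω : Type*} [MeasurableSpace Ω] (μ ν : Measure Ω) : ℝ :=
  (1 / 2) * klDiv μ ((2 : ℝ≥0∞)⁻¹ • (μ + ν)) + (1 / 2) * klDiv ν ((2 : ℝ≥0∞)⁻¹ • (μ + ν))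

/-- Error of a classifier `f : 𝒳 → Fin k` under a domain `D` on `𝒳 × Fin k`. -/
noncomputable def err {𝒳 : Type*} [MeasurableSpace 𝒳] {k : ℕ}
    (D : Measure (𝒳 × Fin k)) (f : 𝒳 → Fin k) : ℝ :=
  (D {p | f p.1 ≠ p.2}).toReal

lemma log_le_sub_one_div_sqrt {x : ℝ} (hx : 1 ≤ x) : log x ≤ (x - 1) / √x := by
  have h0 : 0 < x := by linarith
  have h := Real.self_le_sinh_iff.2 (show 0 ≤ log x / 2 by have := Real.log_nonneg hx; linarith)
  have e : rexp (log x / 2) = √x := by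
    rw [Real.exp_half, Real.exp_log h0]
  rw [Real.sinh_eq, Real.exp_neg, e] at h
  have hs : 0 < √x := Real.sqrt_pos.2 h0
  have : (x - 1) / √x = √x - (√x)⁻¹ := by
    rw [div_eq_iff hs.ne', sub_mul, inv_mul_cancel₀ hs.ne', Real.mul_self_sqrt h0.le]
  linarith

lemma sq_le_mul_log_add_mul_log {x : ℝ} (h0 : 0 ≤ x) (h1 : x ≤ 1) :
    x ^ 2 ≤ (1 + x) * log (1 + x) + (1 - x) * log (1 - x) := by
  have hmono : MonotoneOn (fun x : ℝ => (1 + x) * log (1 + x) + (1 - x) * log (1 - x) - x ^ 2)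
      (Set.Icc 0 1) := by
    refine monotoneOn_of_hasDerivWithinAt_nonneg (f' := fun x => log (1 + x) - log (1 - x) - 2 * x)
      (convex_Icc 0 1) ?_ ?_ ?_
    · have h := Real.continuous_mul_log
      exact (((h.comp (continuous_const.add continuous_id)).add
        (h.comp (continuous_const.sub continuous_id))).sub (continuous_pow 2)).continuousOn
    · intro y hy
      rw [interior_Icc] at hy
      have ha : (1 + y) ≠ 0 := by linarith [hy.1]
      have hb : (1 - y) ≠ 0 := by linarith [hy.2]
      have da := (Real.hasDerivAt_mul_log ha).comp y ((hasDerivAt_id y).const_add 1)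
      have db := (Real.hasDerivAt_mul_log hb).comp y ((hasDerivAt_id y).const_sub 1)
      exact (((da.add db).sub (hasDerivAt_pow 2 y)).congr_deriv
        (by push_cast; ring)).hasDerivWithinAt
    · intro y hy
      rw [interior_Icc] at hy
      have hb : 0 < 1 - y := by linarith [hy.2]
      have h := Real.le_log_one_add_of_nonneg
        (show 0 ≤ 2 * y / (1 - y) by have := hy.1; positivity)
      have e1 : 1 + 2 * y / (1 - y) = (1 + y) / (1 - y) := by field_simp; ring
      have e2 : 2 * (2 * y / (1 - y)) / (2 * y / (1 - y) + 2) = 2 * y := by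
        have : 2 * y / (1 - y) + 2 = 2 / (1 - y) := by field_simp; ring
        rw [this]; field_simp
      rw [e1, e2, Real.log_div (by linarith [hy.1]) hb.ne'] at h
      linarith
  have := hmono (Set.left_mem_Icc.2 zero_le_one) ⟨h0, h1⟩ h0
  simp at this
  linarith

/-- Twice the contribution of one atom to the Jensen–Shannon divergence. -/
noncomputable def jsAtom (p q : ℝ) : ℝ :=
  p * log p + q * log q - (p + q) * log (p + q) + (p + q) * log 2

lemma jsAtom_comm (p q : ℝ) : jsAtom p q = jsAtom q p := by
  unfold jsAtom; rw [add_comm q p]; ring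

lemma jsAtom_eq {p q : ℝ} (hp : 0 ≤ p) (hq : 0 ≤ q) :
    jsAtom p q = p * log (2 * p / (p + q)) + q * log (2 * q / (p + q)) := by
  unfold jsAtom
  rcases hp.eq_or_lt with rfl | hp
  · rcases hq.eq_or_lt with rfl | hq
    · simp
    · simp [hq.ne']
  · rcases hq.eq_or_lt with rfl | hq
    · simp [hp.ne']
    · rw [Real.log_div (by positivity) (by positivity), Real.log_div (by positivity) (by positivity),
        Real.log_mul (by positivity) (by positivity), Real.log_mul (by positivity) (by positivity)]
      ring

lemma jsAtom_lower {a b : ℝ} (ha : 0 ≤ a) (hab : a ≤ b) (hb : 0 < b) :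
    (b - a) ^ 2 / (2 * (a + b)) ≤ jsAtom a b := by
  have hs : 0 < a + b := by linarith
  have h := sq_le_mul_log_add_mul_log (x := (b - a) / (a + b))
    (div_nonneg (by linarith) hs.le) ((div_le_one hs).2 (by linarith))
  have e1 : 1 + (b - a) / (a + b) = 2 * b / (a + b) := by field_simp; ring
  have e2 : 1 - (b - a) / (a + b) = 2 * a / (a + b) := by field_simp; ring
  rw [e1, e2] at h
  rw [jsAtom_eq ha (ha.trans hab)]
  calc (b - a) ^ 2 / (2 * (a + b)) = (a + b) / 2 * ((b - a) / (a + b)) ^ 2 := by field_simp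
    _ ≤ (a + b) / 2 * _ := mul_le_mul_of_nonneg_left h (by positivity)
    _ = _ := by field_simp; ring

lemma jsAtom_nonneg_of_le {a b : ℝ} (ha : 0 ≤ a) (hab : a ≤ b) : 0 ≤ jsAtom a b := by
  rcases (ha.trans hab).eq_or_lt with rfl | hb
  · obtain rfl : a = 0 := le_antisymm hab ha
    simp [jsAtom]
  · exact le_trans (by positivity) (jsAtom_lower ha hab hb)

lemma jsAtom_nonneg {p q : ℝ} (hp : 0 ≤ p) (hq : 0 ≤ q) : 0 ≤ jsAtom p q := by
  rcases le_total p q with h | h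
  · exact jsAtom_nonneg_of_le hp h
  · rw [jsAtom_comm]; exact jsAtom_nonneg_of_le hq h

lemma jsAtom_le_sub {a b : ℝ} (ha : 0 ≤ a) (hab : a ≤ b) : jsAtom a b ≤ b - a := by
  rcases (ha.trans hab).eq_or_lt with rfl | hb
  · obtain rfl : a = 0 := le_antisymm hab ha
    simp [jsAtom]
  rw [jsAtom_eq ha hb.le]
  have hs : 0 < a + b := by linarith
  have h1 : a * log (2 * a / (a + b)) ≤ a * (2 * a / (a + b) - 1) := by
    rcases ha.eq_or_lt with rfl | ha
    · simp
    · exact mul_le_mul_of_nonneg_left (Real.log_le_sub_one_of_pos (by positivity)) ha.le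
  have h2 : b * log (2 * b / (a + b)) ≤ b * (2 * b / (a + b) - 1) :=
    mul_le_mul_of_nonneg_left (Real.log_le_sub_one_of_pos (by positivity)) hb.le
  have h3 : a * (2 * a / (a + b) - 1) + b * (2 * b / (a + b) - 1) = (b - a) ^ 2 / (a + b) := by
    field_simp; ring
  have h4 : (b - a) ^ 2 / (a + b) ≤ b - a := by
    rw [div_le_iff₀ hs]; nlinarith
  linarith

/-- The defect of additivity of `jsAtom` along `a ≤ b ≤ c`, in mean value form. -/
lemma exists_jsAtom_eq_add {a b c : ℝ} (ha : 0 ≤ a) (hab : a < b) (hbc : b ≤ c) :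
    ∃ s, a < s ∧ s < b ∧
      jsAtom a c = jsAtom a b + jsAtom b c + (b - a) * log ((s + c) / (s + b)) := by
  have hb : 0 < b := by linarith
  have hc : 0 < c := by linarith
  obtain ⟨s, hs, h⟩ := exists_hasDerivAt_eq_slope
    (fun s => (s + c) * log (s + c) - (s + b) * log (s + b))
    (fun s => log (s + c) - log (s + b)) hab
    (by
      have h := Real.continuous_mul_log
      exact ((h.comp (continuous_id.add continuous_const)).sub
        (h.comp (continuous_id.add continuous_const))).continuousOn)
    (by
      intro y hy
      have hyc : y + c ≠ 0 := by linarith [hy.1]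
      have hyb : y + b ≠ 0 := by linarith [hy.1]
      have dc := (Real.hasDerivAt_mul_log hyc).comp y ((hasDerivAt_id y).add_const c)
      have db := (Real.hasDerivAt_mul_log hyb).comp y ((hasDerivAt_id y).add_const b)
      exact (dc.sub db).congr_deriv (by ring))
  refine ⟨s, hs.1, hs.2, ?_⟩
  rw [eq_div_iff (by linarith)] at h
  rw [Real.log_div (by linarith [hs.1]) (by linarith [hs.1]), mul_comm (b - a), h]
  have e : log (b + b) = log 2 + log b := by
    rw [← two_mul, Real.log_mul two_ne_zero hb.ne']
  unfold jsAtom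
  rw [e]
  ring

lemma jsAtom_add_le {a b c : ℝ} (ha : 0 ≤ a) (hab : a ≤ b) (hbc : b ≤ c) :
    jsAtom a b + jsAtom b c ≤ jsAtom a c := by
  rcases hab.eq_or_lt with rfl | hab
  · have := jsAtom_le_sub ha le_rfl
    linarith
  obtain ⟨s, hs, -, h⟩ := exists_jsAtom_eq_add ha hab hbc
  have : 0 ≤ log ((s + c) / (s + b)) :=
    Real.log_nonneg ((one_le_div (by linarith)).2 (by linarith))
  have := mul_nonneg (sub_nonneg.2 hab.le) this
  linarith

lemma sqrt_le_sqrt_add_sqrt_of_sq_le {x y u d C : ℝ} (hy : 0 ≤ y) (hd : 0 ≤ d) (hu : u ≤ d)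
    (hx : x ≤ y + u + C) (hC : C ^ 2 ≤ 4 * (y * d)) : √x ≤ √y + √d := by
  refine Real.sqrt_le_iff.2 ⟨by positivity, ?_⟩
  have h : C ≤ 2 * (√y * √d) := by
    refine le_of_sq_le_sq ?_ (by positivity)
    rw [mul_pow, mul_pow, Real.sq_sqrt hy, Real.sq_sqrt hd]; linarith
  nlinarith [Real.sq_sqrt hy, Real.sq_sqrt hd]

lemma sqrt_jsAtom_le_of_le_right {a b c : ℝ} (ha : 0 ≤ a) (hab : a ≤ b) (hbc : b ≤ c) :
    √(jsAtom a c) ≤ √(jsAtom a b) + √(c - b) := by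
  rcases hab.eq_or_lt with rfl | hab
  · have := Real.sqrt_le_sqrt (jsAtom_le_sub ha hbc)
    linarith [Real.sqrt_nonneg (jsAtom a a)]
  obtain ⟨s, hs, hsb, h⟩ := exists_jsAtom_eq_add ha hab hbc
  refine sqrt_le_sqrt_add_sqrt_of_sq_le (jsAtom_nonneg_of_le ha hab.le) (sub_nonneg.2 hbc)
    (jsAtom_le_sub (ha.trans hab.le) hbc) h.le ?_
  have hb : 0 < s + b := by linarith
  have hx : 1 ≤ (s + c) / (s + b) := (one_le_div hb).2 (by linarith)
  have hl : log ((s + c) / (s + b)) ^ 2 ≤ (c - b) / (s + c) * ((c - b) / (s + b)) := by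
    calc log ((s + c) / (s + b)) ^ 2 ≤ (((s + c) / (s + b) - 1) / √((s + c) / (s + b))) ^ 2 :=
          pow_le_pow_left₀ (Real.log_nonneg hx) (log_le_sub_one_div_sqrt hx) 2
      _ = _ := by
          rw [div_pow, Real.sq_sqrt (by linarith)]
          have : s + c ≠ 0 := by linarith
          field_simp
          ring
  have hl2 : log ((s + c) / (s + b)) ^ 2 ≤ (c - b) / (a + b) := by
    refine hl.trans ?_
    calc _ ≤ 1 * ((c - b) / (a + b)) := by
          refine mul_le_mul ((div_le_one (by linarith)).2 (by linarith)) ?_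
            (div_nonneg (by linarith) (by linarith)) zero_le_one
          exact div_le_div_of_nonneg_left (by linarith) (by linarith) (by linarith)
      _ = _ := one_mul _
  have hL := jsAtom_lower ha hab.le (by linarith)
  calc ((b - a) * log ((s + c) / (s + b))) ^ 2
      = (b - a) ^ 2 * log ((s + c) / (s + b)) ^ 2 := mul_pow _ _ _
    _ ≤ (b - a) ^ 2 * ((c - b) / (a + b)) := by gcongr
    _ = 2 * ((b - a) ^ 2 / (2 * (a + b)) * (c - b)) := by
        have : a + b ≠ 0 := by linarith
        field_simp
    _ ≤ 2 * (jsAtom a b * (c - b)) := by gcongr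
    _ ≤ _ := by
        have := mul_nonneg (jsAtom_nonneg_of_le ha hab.le) (sub_nonneg.2 hbc)
        linarith

lemma sqrt_jsAtom_le_of_le_left {a b c : ℝ} (ha : 0 ≤ a) (hab : a ≤ b) (hbc : b ≤ c) :
    √(jsAtom a c) ≤ √(jsAtom b c) + √(b - a) := by
  rcases hab.eq_or_lt with rfl | hab
  · simp
  obtain ⟨s, hs, hsb, h⟩ := exists_jsAtom_eq_add ha hab hbc
  have hb0 : 0 < b := by linarith
  refine sqrt_le_sqrt_add_sqrt_of_sq_le (u := jsAtom a b)
    (C := (b - a) * log ((s + c) / (s + b))) (jsAtom_nonneg_of_le hb0.le hbc)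
    (sub_nonneg.2 hab.le) (jsAtom_le_sub ha hab.le) (h.le.trans_eq (by ring)) ?_
  have hb : 0 < s + b := by linarith
  have hx : 1 ≤ (s + c) / (s + b) := (one_le_div hb).2 (by linarith)
  have hl : log ((s + c) / (s + b)) ^ 2 ≤ (c - b) ^ 2 / ((s + c) * (s + b)) := by
    calc log ((s + c) / (s + b)) ^ 2 ≤ (((s + c) / (s + b) - 1) / √((s + c) / (s + b))) ^ 2 :=
          pow_le_pow_left₀ (Real.log_nonneg hx) (log_le_sub_one_div_sqrt hx) 2
      _ = _ := by
          rw [div_pow, Real.sq_sqrt (by linarith)]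
          have : s + c ≠ 0 := by linarith
          field_simp
          ring
  have hl2 : (b - a) * log ((s + c) / (s + b)) ^ 2 ≤ 2 * (c - b) ^ 2 / (b + c) := by
    calc _ ≤ (b - a) * ((c - b) ^ 2 / ((s + c) * (s + b))) := by gcongr
      _ = (c - b) ^ 2 * ((b - a) / ((s + c) * (s + b))) := by ring
      _ ≤ (c - b) ^ 2 * (2 / (b + c)) := by
          refine mul_le_mul_of_nonneg_left ?_ (sq_nonneg _)
          rw [div_le_div_iff₀ (mul_pos (by linarith) hb) (by linarith)]
          have hs0 : 0 < s := by linarith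
          have hc0 : 0 < c := by linarith
          nlinarith [mul_pos hs0 hb0, mul_pos hs0 hc0, mul_pos hb0 hc0, mul_nonneg ha hb0.le,
            mul_nonneg ha hc0.le, mul_nonneg hb0.le (sub_nonneg.2 hbc)]
      _ = _ := by ring
  have hL := jsAtom_lower hb0.le hbc (by linarith)
  calc ((b - a) * log ((s + c) / (s + b))) ^ 2
      = (b - a) * ((b - a) * log ((s + c) / (s + b)) ^ 2) := by ring
    _ ≤ (b - a) * (2 * (c - b) ^ 2 / (b + c)) := mul_le_mul_of_nonneg_left hl2 (by linarith)
    _ = 4 * ((c - b) ^ 2 / (2 * (b + c)) * (b - a)) := by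
        have : b + c ≠ 0 := by linarith
        field_simp
        ring
    _ ≤ 4 * (jsAtom b c * (b - a)) := by gcongr

lemma sqrt_jsAtom_le {p p' q : ℝ} (hp : 0 ≤ p) (hp' : 0 ≤ p') (hq : 0 ≤ q) :
    √(jsAtom p q) ≤ √(jsAtom p' q) + √|p - p'| := by
  have hn := Real.sqrt_nonneg (jsAtom p' q)
  have hd := Real.sqrt_nonneg |p - p'|
  rcases le_total p q with hpq | hpq
  · rcases le_total p' p with h | h
    · have := Real.sqrt_le_sqrt (show jsAtom p q ≤ jsAtom p' q by
        linarith [jsAtom_add_le hp' h hpq, jsAtom_nonneg hp' hp])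
      linarith
    rw [abs_sub_comm, abs_of_nonneg (sub_nonneg.2 h)]
    rcases le_total p' q with h' | h'
    · exact sqrt_jsAtom_le_of_le_left hp h h'
    · have := Real.sqrt_le_sqrt (show jsAtom p q ≤ p' - p by linarith [jsAtom_le_sub hp hpq])
      linarith
  · rcases le_total p p' with h | h
    · have := Real.sqrt_le_sqrt (show jsAtom p q ≤ jsAtom p' q by
        rw [jsAtom_comm p, jsAtom_comm p']
        linarith [jsAtom_add_le hq hpq h, jsAtom_nonneg hp hp'])
      linarith
    rw [abs_of_nonneg (sub_nonneg.2 h)]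
    rcases le_total p' q with h' | h'
    · have := Real.sqrt_le_sqrt (show jsAtom p q ≤ p - p' by
        rw [jsAtom_comm]; linarith [jsAtom_le_sub hq hpq])
      linarith
    · rw [jsAtom_comm p, jsAtom_comm p']
      exact sqrt_jsAtom_le_of_le_right hq h' h

lemma sqrt_sum_le_of_sqrt_le {ι : Type*} (s : Finset ι) {x y z : ι → ℝ}
    (hx : ∀ i, 0 ≤ x i) (hy : ∀ i, 0 ≤ y i) (hz : ∀ i, 0 ≤ z i)
    (h : ∀ i, √(x i) ≤ √(y i) + √(z i)) :
    √(∑ i ∈ s, x i) ≤ √(∑ i ∈ s, y i) + √(∑ i ∈ s, z i) := by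
  have hM := Real.Lp_add_le s (fun i => √(y i)) (fun i => √(z i)) (p := 2) one_le_two
  simp only [Real.rpow_two, sq_abs, ← Real.sqrt_eq_rpow, Real.sq_sqrt (hy _),
    Real.sq_sqrt (hz _)] at hM
  refine le_trans (Real.sqrt_le_sqrt (Finset.sum_le_sum fun i _ => ?_)) hM
  rw [← Real.sq_sqrt (hx i)]
  exact pow_le_pow_left₀ (Real.sqrt_nonneg _) (h i) 2

section JensenShannon

variable {Ω Ω' : Type*} [MeasurableSpace Ω] [MeasurableSpace Ω']

lemma two_smul_mixture (μ ν : Measure Ω) :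
    (2 : ℝ≥0∞) • ((2 : ℝ≥0∞)⁻¹ • (μ + ν)) = μ + ν := by
  rw [smul_smul, ENNReal.mul_inv_cancel two_ne_zero ENNReal.ofNat_ne_top, one_smul]

lemma left_le_two_smul_mixture (μ ν : Measure Ω) :
    μ ≤ (2 : ℝ≥0∞) • ((2 : ℝ≥0∞)⁻¹ • (μ + ν)) := by
  rw [two_smul_mixture]
  exact Measure.le_add_right le_rfl

lemma isProbabilityMeasure_mixture (μ ν : Measure Ω) [IsProbabilityMeasure μ]
    [IsProbabilityMeasure ν] : IsProbabilityMeasure ((2 : ℝ≥0∞)⁻¹ • (μ + ν)) := by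
  constructor
  simp only [Measure.smul_apply, Measure.add_apply, measure_univ, smul_eq_mul, one_add_one_eq_two]
  exact ENNReal.inv_mul_cancel two_ne_zero ENNReal.ofNat_ne_top

lemma absolutelyContinuous_of_le_two_smul {μ ν : Measure Ω} (h : μ ≤ (2 : ℝ≥0∞) • ν) : μ ≪ ν :=
  (Measure.absolutelyContinuous_of_le h).trans (Measure.smul_absolutelyContinuous)

lemma integrable_llr_of_le_two_smul {μ ν : Measure Ω} [IsFiniteMeasure μ] [IsFiniteMeasure ν]
    (h : μ ≤ (2 : ℝ≥0∞) • ν) : Integrable (llr μ ν) μ := by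
  have hac := absolutelyContinuous_of_le_two_smul h
  rw [← InformationTheory.integrable_klFun_rnDeriv_iff hac]
  have hle : μ.rnDeriv ν ≤ᵐ[ν] fun _ => 2 := by
    refine ae_le_of_forall_setLIntegral_le_of_sigmaFinite (Measure.measurable_rnDeriv _ _) ?_
    intro s _ _
    rw [Measure.setLIntegral_rnDeriv hac, setLIntegral_const]
    simpa using h s
  refine Integrable.of_bound (C := 1) (InformationTheory.measurable_klFun.comp
    (Measure.measurable_rnDeriv _ _).ennreal_toReal).aestronglyMeasurable ?_
  filter_upwards [hle] with x hx
  have h0 : 0 ≤ (μ.rnDeriv ν x).toReal := ENNReal.toReal_nonneg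
  have h2 : (μ.rnDeriv ν x).toReal ≤ 2 :=
    ENNReal.toReal_le_of_le_ofReal (by norm_num) (by simpa using hx)
  rw [Real.norm_of_nonneg (InformationTheory.klFun_nonneg h0), InformationTheory.klFun_apply]
  generalize (μ.rnDeriv ν x).toReal = t at h0 h2
  rcases h0.eq_or_lt with rfl | h0
  · simp
  · nlinarith [mul_le_mul_of_nonneg_left (Real.log_le_sub_one_of_pos h0) h0.le]

lemma klDiv_eq_toReal {μ ν : Measure Ω} [IsProbabilityMeasure μ] [IsProbabilityMeasure ν]
    (h : μ ≪ ν) : klDiv μ ν = (InformationTheory.klDiv μ ν).toReal :=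
  (InformationTheory.toReal_klDiv_of_measure_eq h (by simp)).symm

lemma klDiv_map_le_of_le_two_smul {μ ν : Measure Ω} [IsProbabilityMeasure μ]
    [IsProbabilityMeasure ν] (h : μ ≤ (2 : ℝ≥0∞) • ν) {g : Ω → Ω'} (hg : Measurable g) :
    klDiv (μ.map g) (ν.map g) ≤ klDiv μ ν := by
  have hac := absolutelyContinuous_of_le_two_smul h
  have := Measure.isProbabilityMeasure_map (μ := μ) hg.aemeasurable
  have := Measure.isProbabilityMeasure_map (μ := ν) hg.aemeasurable
  rw [klDiv_eq_toReal hac, klDiv_eq_toReal (hac.map hg)]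
  exact ENNReal.toReal_mono
    (InformationTheory.klDiv_ne_top hac (integrable_llr_of_le_two_smul h))
    (InformationTheory.klDiv_map_le μ ν hg)

lemma jsDiv_comm (μ ν : Measure Ω) : jsDiv μ ν = jsDiv ν μ := by
  unfold jsDiv
  rw [add_comm ν μ, add_comm]

/-- Data processing inequality for the Jensen–Shannon divergence. -/
lemma jsDiv_map_le (μ ν : Measure Ω) [IsProbabilityMeasure μ] [IsProbabilityMeasure ν]
    {g : Ω → Ω'} (hg : Measurable g) : jsDiv (μ.map g) (ν.map g) ≤ jsDiv μ ν := by
  have := isProbabilityMeasure_mixture μ ν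
  have h1 := klDiv_map_le_of_le_two_smul (left_le_two_smul_mixture μ ν) hg
  have h2 := klDiv_map_le_of_le_two_smul
    (show ν ≤ (2 : ℝ≥0∞) • ((2 : ℝ≥0∞)⁻¹ • (μ + ν)) by
      rw [add_comm]; exact left_le_two_smul_mixture ν μ) hg
  rw [Measure.map_smul, Measure.map_add _ _ hg] at h1 h2
  unfold jsDiv
  linarith

variable {ι : Type*} [Fintype ι] [MeasurableSpace ι] [MeasurableSingletonClass ι]

lemma klDiv_mixture_eq_sum (μ ν : Measure ι) [IsProbabilityMeasure μ] [IsProbabilityMeasure ν] :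
    klDiv μ ((2 : ℝ≥0∞)⁻¹ • (μ + ν)) =
      ∑ i, μ.real {i} * log (2 * μ.real {i} / (μ.real {i} + ν.real {i})) := by
  have := isProbabilityMeasure_mixture μ ν
  have hac := absolutelyContinuous_of_le_two_smul (left_le_two_smul_mixture μ ν)
  unfold klDiv
  rw [integral_fintype .of_finite]
  refine Finset.sum_congr rfl fun i _ => ?_
  rw [smul_eq_mul]
  have h := Measure.setLIntegral_rnDeriv hac {i}
  rw [lintegral_singleton] at h
  replace h := congrArg ENNReal.toReal h
  simp only [ENNReal.toReal_mul, Measure.smul_apply, Measure.add_apply, smul_eq_mul,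
    ENNReal.toReal_inv, ENNReal.toReal_ofNat,
    ENNReal.toReal_add (measure_ne_top μ {i}) (measure_ne_top ν {i})] at h
  simp only [← measureReal_def] at h
  rcases (measureReal_nonneg (μ := μ) (s := {i})).eq_or_lt with h0 | h0
  · simp [← h0]
  · have hn := measureReal_nonneg (μ := ν) (s := {i})
    congr 2
    rw [eq_div_iff (by positivity)]
    linarith

lemma jsDiv_eq_sum (μ ν : Measure ι) [IsProbabilityMeasure μ] [IsProbabilityMeasure ν] :
    jsDiv μ ν = (1 / 2) * ∑ i, jsAtom (μ.real {i}) (ν.real {i}) := by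
  have h := klDiv_mixture_eq_sum ν μ
  rw [add_comm ν μ] at h
  unfold jsDiv
  rw [klDiv_mixture_eq_sum, h, ← mul_add, ← Finset.sum_add_distrib]
  congr 1
  refine Finset.sum_congr rfl fun i _ => ?_
  rw [jsAtom_eq measureReal_nonneg measureReal_nonneg, add_comm (ν.real {i})]

lemma sqrt_jsDiv_le (μ μ' ν : Measure ι) [IsProbabilityMeasure μ] [IsProbabilityMeasure μ']
    [IsProbabilityMeasure ν] :
    √(jsDiv μ ν) ≤ √(jsDiv μ' ν) + √((1 / 2) * ∑ i, |μ.real {i} - μ'.real {i}|) := by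
  simp only [jsDiv_eq_sum, Real.sqrt_mul (show (0 : ℝ) ≤ 1 / 2 by norm_num), ← mul_add]
  refine mul_le_mul_of_nonneg_left ?_ (Real.sqrt_nonneg _)
  exact sqrt_sum_le_of_sqrt_le _ (fun i => jsAtom_nonneg measureReal_nonneg measureReal_nonneg)
    (fun i => jsAtom_nonneg measureReal_nonneg measureReal_nonneg) (fun i => abs_nonneg _)
    (fun i => sqrt_jsAtom_le measureReal_nonneg measureReal_nonneg measureReal_nonneg)

/-- The coupling inequality for the total variation distance on a finite type. -/
lemma half_sum_abs_sub_le (D : Measure Ω) [IsFiniteMeasure D] {X Y : Ω → ι}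
    (hX : Measurable X) (hY : Measurable Y) :
    (1 / 2) * ∑ i, |(D.map X).real {i} - (D.map Y).real {i}| ≤ D.real {ω | Y ω ≠ X ω} := by
  have hm : MeasurableSet {ω | Y ω ≠ X ω} := by
    have : {ω | Y ω ≠ X ω} = ⋃ i, (Y ⁻¹' {i} ∩ (X ⁻¹' {i})ᶜ) := by
      ext ω; simp [eq_comm]
    rw [this]
    exact .iUnion fun i => (hY (.singleton i)).inter (hX (.singleton i)).compl
  have key : ∀ {Z : Ω → ι}, Measurable Z →
      ∑ i, D.real (Z ⁻¹' {i} ∩ {ω | Y ω ≠ X ω}) = D.real {ω | Y ω ≠ X ω} := by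
    intro Z hZ
    rw [← measureReal_biUnion_finset]
    · congr 1
      ext ω; simp
    · intro i _ j _ hij
      refine Set.disjoint_left.2 fun ω h1 h2 => hij ?_
      exact h1.1.symm.trans h2.1
    · exact fun i _ => (hZ (.singleton i)).inter hm
  have hi : ∀ i, |(D.map X).real {i} - (D.map Y).real {i}| ≤
      D.real (X ⁻¹' {i} ∩ {ω | Y ω ≠ X ω}) + D.real (Y ⁻¹' {i} ∩ {ω | Y ω ≠ X ω}) := by
    intro i
    rw [map_measureReal_apply hX (.singleton i), map_measureReal_apply hY (.singleton i)]
    have e : X ⁻¹' {i} \ {ω | Y ω ≠ X ω} = Y ⁻¹' {i} \ {ω | Y ω ≠ X ω} := by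
      ext ω
      simp only [Set.mem_sdiff, Set.mem_preimage, Set.mem_singleton_iff, Set.mem_ofPred_eq, not_not]
      exact and_congr_left fun h => by rw [h]
    have h1 := measureReal_inter_add_sdiff (μ := D) (s := X ⁻¹' {i}) hm
    have h2 := measureReal_inter_add_sdiff (μ := D) (s := Y ⁻¹' {i}) hm
    rw [e] at h1
    have p1 := measureReal_nonneg (μ := D) (s := X ⁻¹' {i} ∩ {ω | Y ω ≠ X ω})
    have p2 := measureReal_nonneg (μ := D) (s := Y ⁻¹' {i} ∩ {ω | Y ω ≠ X ω})
    rw [abs_le]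
    constructor <;> linarith
  have := Finset.sum_le_sum fun i (_ : i ∈ Finset.univ) => hi i
  rw [Finset.sum_add_distrib, key hX, key hY] at this
  linarith

end JensenShannon

/-- Lower bound on the joint error in terms of the JSD between label marginals and the
JSD between the pushforward feature distributions. -/
theorem joint_error_lower_bound
    {𝒳 Z : Type*} [MeasurableSpace 𝒳] [MeasurableSpace Z] {k : ℕ} (hk : 2 ≤ k)
    (DS DT : Measure (𝒳 × Fin k)) [IsProbabilityMeasure DS] [IsProbabilityMeasure DT]
    (φ : 𝒳 → Z) (hφ : Measurable φ) (l : Z → Fin k) (hl : Measurable l)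
    (hJS : jsDiv (DS.map Prod.snd) (DT.map Prod.snd) ≥
      jsDiv (DS.map fun p => φ p.1) (DT.map fun p => φ p.1)) :
    err DS (l ∘ φ) + err DT (l ∘ φ) ≥
      (1 / 2) * (Real.sqrt (jsDiv (DS.map Prod.snd) (DT.map Prod.snd)) -
        Real.sqrt (jsDiv (DS.map fun p => φ p.1) (DT.map fun p => φ p.1))) ^ 2 := by
  have hp : Measurable fun p : 𝒳 × Fin k => φ p.1 := hφ.comp measurable_fst
  have hf : Measurable fun p : 𝒳 × Fin k => (l ∘ φ) p.1 := hl.comp hp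
  have hmap (D : Measure (𝒳 × Fin k)) :
      (D.map fun p => φ p.1).map l = D.map fun p => (l ∘ φ) p.1 := Measure.map_map hl hp
  have := Measure.isProbabilityMeasure_map (μ := DS) (measurable_snd.aemeasurable)
  have := Measure.isProbabilityMeasure_map (μ := DT) (measurable_snd.aemeasurable)
  have := Measure.isProbabilityMeasure_map (μ := DS) hp.aemeasurable
  have := Measure.isProbabilityMeasure_map (μ := DT) hp.aemeasurable
  have := Measure.isProbabilityMeasure_map (μ := DS) hf.aemeasurable
  have := Measure.isProbabilityMeasure_map (μ := DT) hf.aemeasurable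
  have hdp := Real.sqrt_le_sqrt
    (jsDiv_map_le (DS.map fun p => φ p.1) (DT.map fun p => φ p.1) hl)
  rw [hmap, hmap] at hdp
  have h1 := sqrt_jsDiv_le (DS.map Prod.snd) (DS.map fun p => (l ∘ φ) p.1) (DT.map Prod.snd)
  have h2 := sqrt_jsDiv_le (DT.map Prod.snd) (DT.map fun p => (l ∘ φ) p.1)
    (DS.map fun p => (l ∘ φ) p.1)
  rw [jsDiv_comm (DT.map Prod.snd), jsDiv_comm (DT.map _)] at h2
  have e1 := Real.sqrt_le_sqrt (half_sum_abs_sub_le DS measurable_snd hf)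
  have e2 := Real.sqrt_le_sqrt (half_sum_abs_sub_le DT measurable_snd hf)
  change _ ≤ √(err DS (l ∘ φ)) at e1
  change _ ≤ √(err DT (l ∘ φ)) at e2
  have hd := sub_nonneg.2 (Real.sqrt_le_sqrt hJS)
  have hle : √(jsDiv (DS.map Prod.snd) (DT.map Prod.snd)) -
      √(jsDiv (DS.map fun p => φ p.1) (DT.map fun p => φ p.1)) ≤
      √(err DS (l ∘ φ)) + √(err DT (l ∘ φ)) := by linarith
  have hsq := pow_le_pow_left₀ hd hle 2
  have s1 : √(err DS (l ∘ φ)) ^ 2 = err DS (l ∘ φ) := Real.sq_sqrt ENNReal.toReal_nonneg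
  have s2 : √(err DT (l ∘ φ)) ^ 2 = err DT (l ∘ φ) := Real.sq_sqrt ENNReal.toReal_nonneg
  nlinarith [sq_nonneg (√(err DS (l ∘ φ)) - √(err DT (l ∘ φ)))]
end

section
/- For any measurable feature map g : 𝒳 → 𝒵 and measurable hypothesis h : 𝒵 → 𝒴, with Ŷ = h(g(X)), the error gap satisfies |ε_S(h∘g) − ε_T(h∘g)| ≤ ‖D_S^Y − D_T^Y‖₁ · BER_{D_S}(Ŷ‖Y) + 2(k−1)·Δ_CE(Ŷ), where ‖D_S^Y − D_T^Y‖₁ := Σ_{i∈𝒴} |D_S(Y=i) − D_T(Y=i)|. -/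
open MeasureTheory Real
open scoped ENNReal

/-- Conditional probability of the event `A` given `Y = y` under the domain `D`. -/
noncomputable def condProb {𝒳 : Type*} [MeasurableSpace 𝒳] {k : ℕ}
    (D : Measure (𝒳 × Fin k)) (A : Set (𝒳 × Fin k)) (y : Fin k) : ℝ :=
  (D (A ∩ {p | p.2 = y})).toReal / (D {p | p.2 = y}).toReal

/-- Balanced error rate `BER_D(Ŷ‖Y) = max_j D(Ŷ ≠ Y | Y = j)` of the classifier `f` on `D`. -/
noncomputable def BER {𝒳 : Type*} [MeasurableSpace 𝒳] {k : ℕ}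
    (D : Measure (𝒳 × Fin k)) (f : 𝒳 → Fin k) : ℝ :=
  ⨆ j : Fin k, condProb D {p | f p.1 ≠ p.2} j

/-- Conditional error gap `Δ_CE(Ŷ) = max_{y ≠ y'} |D_S(Ŷ = y' | Y = y) − D_T(Ŷ = y' | Y = y)|`. -/
noncomputable def condErrGap {𝒳 : Type*} [MeasurableSpace 𝒳] {k : ℕ}
    (DS DT : Measure (𝒳 × Fin k)) (f : 𝒳 → Fin k) : ℝ :=
  ⨆ q : {q : Fin k × Fin k // q.1 ≠ q.2},
    |condProb DS {p | f p.1 = q.1.2} q.1.1 - condProb DT {p | f p.1 = q.1.2} q.1.1|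

section ConditionalProbabilities

variable {𝒳 : Type*} [MeasurableSpace 𝒳] {k : ℕ}

theorem measurableSet_label_eq (j : Fin k) : MeasurableSet {p : 𝒳 × Fin k | p.2 = j} :=
  measurable_snd (measurableSet_singleton j)

theorem measurableSet_prediction_eq {f : 𝒳 → Fin k} (hf : Measurable f) (j : Fin k) :
    MeasurableSet {p : 𝒳 × Fin k | f p.1 = j} :=
  (hf.comp measurable_fst) (measurableSet_singleton j)

theorem condProb_nonneg (D : Measure (𝒳 × Fin k)) (A : Set (𝒳 × Fin k)) (y : Fin k) :
    0 ≤ condProb D A y :=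
  div_nonneg ENNReal.toReal_nonneg ENNReal.toReal_nonneg

theorem sum_label_prob (D : Measure (𝒳 × Fin k)) [IsProbabilityMeasure D] :
    ∑ j, (D {p | p.2 = j}).toReal = 1 := by
  have h := sum_measureReal_preimage_singleton (μ := D) Finset.univ
    (f := fun p : 𝒳 × Fin k => p.2) fun j _ => measurableSet_label_eq j
  rw [Finset.coe_univ, Set.preimage_univ, probReal_univ] at h
  exact h

/-- Law of total probability for the error. -/
theorem err_eq_sum_condProb (D : Measure (𝒳 × Fin k)) [IsFiniteMeasure D]
    (hD : ∀ j : Fin k, 0 < D {p | p.2 = j}) {f : 𝒳 → Fin k} (hf : Measurable f) :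
    err D f = ∑ j, condProb D {p | f p.1 ≠ p.2} j * (D {p | p.2 = j}).toReal := by
  have hE : MeasurableSet {p : 𝒳 × Fin k | f p.1 ≠ p.2} :=
    (measurableSet_eq_fun (hf.comp measurable_fst) measurable_snd).compl
  have h := measureReal_biUnion_finset (μ := D) (s := Finset.univ)
    (f := fun j : Fin k => {p : 𝒳 × Fin k | f p.1 ≠ p.2} ∩ {p | p.2 = j})
    (fun i _ j _ hij => Set.disjoint_left.2 fun p hi hj => hij (hi.2.symm.trans hj.2))
    (fun j _ => hE.inter (measurableSet_label_eq j))
  have hU : (⋃ j ∈ (Finset.univ : Finset (Fin k)),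
      {p : 𝒳 × Fin k | f p.1 ≠ p.2} ∩ {p | p.2 = j}) = {p | f p.1 ≠ p.2} := by
    ext p; simp
  rw [hU] at h
  refine h.trans (Finset.sum_congr rfl fun j _ => ?_)
  exact (div_mul_cancel₀ _ (ENNReal.toReal_pos (hD j).ne' (measure_ne_top _ _)).ne').symm

/-- The conditional error given a label splits over the wrong predictions. -/
theorem condProb_ne_eq_sum (D : Measure (𝒳 × Fin k)) [IsFiniteMeasure D]
    {f : 𝒳 → Fin k} (hf : Measurable f) (j : Fin k) :
    condProb D {p | f p.1 ≠ p.2} j =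
      ∑ i ∈ Finset.univ.erase j, condProb D {p | f p.1 = i} j := by
  have h := measureReal_biUnion_finset (μ := D) (s := Finset.univ.erase j)
    (f := fun i : Fin k => {p : 𝒳 × Fin k | f p.1 = i} ∩ {p | p.2 = j})
    (fun a _ b _ hab => Set.disjoint_left.2 fun p ha hb => hab (ha.1.symm.trans hb.1))
    (fun i _ => (measurableSet_prediction_eq hf i).inter (measurableSet_label_eq j))
  have hU : (⋃ i ∈ (Finset.univ : Finset (Fin k)).erase j,
      {p : 𝒳 × Fin k | f p.1 = i} ∩ {p | p.2 = j}) =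
        {p | f p.1 ≠ p.2} ∩ {p | p.2 = j} := by
    ext p
    simp only [Set.mem_iUnion, Finset.mem_erase, Set.mem_inter_iff, Set.mem_ofPred_eq]
    grind
  rw [hU] at h
  simp only [condProb, ← Finset.sum_div]
  exact congrArg (· / _) h

theorem condErrGap_nonneg (DS DT : Measure (𝒳 × Fin k)) (f : 𝒳 → Fin k) :
    0 ≤ condErrGap DS DT f :=
  Real.iSup_nonneg fun _ => abs_nonneg _

theorem abs_condProb_ne_sub_le (DS DT : Measure (𝒳 × Fin k)) [IsFiniteMeasure DS]
    [IsFiniteMeasure DT] {f : 𝒳 → Fin k} (hf : Measurable f) (j : Fin k) :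
    |condProb DS {p | f p.1 ≠ p.2} j - condProb DT {p | f p.1 ≠ p.2} j| ≤
      ((k : ℝ) - 1) * condErrGap DS DT f := by
  rw [condProb_ne_eq_sum DS hf, condProb_ne_eq_sum DT hf, ← Finset.sum_sub_distrib]
  refine (Finset.abs_sum_le_sum_abs _ _).trans ((Finset.sum_le_card_nsmul _ _
    (condErrGap DS DT f) fun i hi => ?_).trans_eq ?_)
  · exact le_ciSup (f := fun q : {q : Fin k × Fin k // q.1 ≠ q.2} =>
      |condProb DS {p | f p.1 = q.1.2} q.1.1 - condProb DT {p | f p.1 = q.1.2} q.1.1|)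
      (Set.finite_range _).bddAbove ⟨(j, i), (Finset.ne_of_mem_erase hi).symm⟩
  · rw [Finset.card_erase_of_mem (Finset.mem_univ j), Finset.card_fin, nsmul_eq_mul,
      Nat.cast_pred j.pos]

end ConditionalProbabilities

/-- Error decomposition theorem: the error gap is bounded by the `L¹` label-distribution
distance times the balanced error rate, plus `2(k−1)` times the conditional error gap. -/
theorem error_gap_decomposition
    {𝒳 Z : Type*} [MeasurableSpace 𝒳] [MeasurableSpace Z] {k : ℕ} (hk : 2 ≤ k)
    (DS DT : Measure (𝒳 × Fin k)) [IsProbabilityMeasure DS] [IsProbabilityMeasure DT]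
    (hS : ∀ j : Fin k, 0 < DS {p | p.2 = j}) (hT : ∀ j : Fin k, 0 < DT {p | p.2 = j})
    (g : 𝒳 → Z) (hg : Measurable g) (h : Z → Fin k) (hh : Measurable h) :
    |err DS (h ∘ g) - err DT (h ∘ g)| ≤
      (∑ i : Fin k, |(DS {p | p.2 = i}).toReal - (DT {p | p.2 = i}).toReal|) *
          BER DS (h ∘ g) +
        2 * ((k : ℝ) - 1) * condErrGap DS DT (h ∘ g) := by
  have hf : Measurable (h ∘ g) := hh.comp hg
  set f := h ∘ g
  have hk' : (0 : ℝ) ≤ (k : ℝ) - 1 := by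
    have : (2 : ℝ) ≤ k := mod_cast hk
    linarith
  set a := fun j => condProb DS {p | f p.1 ≠ p.2} j with ha
  set b := fun j => condProb DT {p | f p.1 ≠ p.2} j with hb
  set s := fun j : Fin k => (DS {p | p.2 = j}).toReal with hs
  set t := fun j : Fin k => (DT {p | p.2 = j}).toReal with ht
  have hdecomp : err DS f - err DT f = ∑ j, (s j - t j) * a j + ∑ j, t j * (a j - b j) := by
    rw [err_eq_sum_condProb DS hS hf, err_eq_sum_condProb DT hT hf, ← Finset.sum_sub_distrib,
      ← Finset.sum_add_distrib]
    exact Finset.sum_congr rfl fun j _ => by simp only [ha, hb, hs, ht]; ring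
  have hlabel : |∑ j, (s j - t j) * a j| ≤ (∑ j, |s j - t j|) * BER DS f := by
    rw [Finset.sum_mul]
    refine (Finset.abs_sum_le_sum_abs _ _).trans (Finset.sum_le_sum fun j _ => ?_)
    rw [abs_mul, abs_of_nonneg (condProb_nonneg DS _ j : 0 ≤ a j)]
    exact mul_le_mul_of_nonneg_left (le_ciSup (f := a) (Set.finite_range a).bddAbove j)
      (abs_nonneg _)
  have hcond : |∑ j, t j * (a j - b j)| ≤ ((k : ℝ) - 1) * condErrGap DS DT f := by
    rw [← one_mul (((k : ℝ) - 1) * condErrGap DS DT f)]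
    nth_rewrite 1 [← sum_label_prob DT]
    rw [Finset.sum_mul]
    refine (Finset.abs_sum_le_sum_abs _ _).trans (Finset.sum_le_sum fun j _ => ?_)
    rw [abs_mul, abs_of_nonneg (ENNReal.toReal_nonneg : 0 ≤ t j)]
    exact mul_le_mul_of_nonneg_left (abs_condProb_ne_sub_le DS DT hf j) ENNReal.toReal_nonneg
  have hgap := mul_nonneg hk' (condErrGap_nonneg DS DT f)
  rw [hdecomp]
  linarith [abs_add_le (∑ j, (s j - t j) * a j) (∑ j, t j * (a j - b j))]
end

section
/- If a measurable feature map g : 𝒳 → 𝒵 satisfies generalized label shift (GLS), then for any measurable h : 𝒵 → 𝒴, setting Ŷ = h(g(X)), the joint error satisfies ε_S(Ŷ) + ε_T(Ŷ) ≤ 2·BER_{D_S}(Ŷ‖Y). -/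
open MeasureTheory Real
open scoped ENNReal

/-- Generalized label shift: for every label `y`, the conditional distribution of
`Z = g(X)` given `Y = y` is the same under `DS` and `DT`. -/
def GLS {𝒳 Z : Type*} [MeasurableSpace 𝒳] [MeasurableSpace Z] {k : ℕ}
    (DS DT : Measure (𝒳 × Fin k)) (g : 𝒳 → Z) : Prop :=
  ∀ y : Fin k, ∀ E : Set Z, MeasurableSet E →
    condProb DS {p | g p.1 ∈ E} y = condProb DT {p | g p.1 ∈ E} y

/-- The law of total probability over the label. -/
theorem sum_measureReal_inter_label {𝒳 : Type*} [MeasurableSpace 𝒳] {k : ℕ}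
    (D : Measure (𝒳 × Fin k)) [IsFiniteMeasure D] (A : Set (𝒳 × Fin k)) :
    ∑ j, D.real (A ∩ {p | p.2 = j}) = D.real A := by
  have hm (j : Fin k) : MeasurableSet (Prod.snd ⁻¹' {j} : Set (𝒳 × Fin k)) :=
    measurable_snd (measurableSet_singleton j)
  have hsum := sum_measureReal_preimage_singleton (μ := D.restrict A) Finset.univ
    (f := Prod.snd) fun j _ => hm j
  simp only [Finset.coe_univ, Set.preimage_univ, measureReal_restrict_apply_univ] at hsum
  rw [← hsum]
  refine Finset.sum_congr rfl fun j _ => ?_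
  rw [measureReal_restrict_apply (hm j), Set.inter_comm]
  rfl

/-- An event whose conditional probability given each label is at most `b` has probability
at most `b`. -/
theorem measureReal_le_of_condProb_le {𝒳 : Type*} [MeasurableSpace 𝒳] {k : ℕ}
    (D : Measure (𝒳 × Fin k)) [IsProbabilityMeasure D] {A : Set (𝒳 × Fin k)} {b : ℝ}
    (hD : ∀ j : Fin k, 0 < D {p | p.2 = j}) (hA : ∀ j, condProb D A j ≤ b) :
    D.real A ≤ b := by
  have hlabel : ∑ j, D.real {p : 𝒳 × Fin k | p.2 = j} = 1 := by
    simpa using sum_measureReal_inter_label D Set.univ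
  calc D.real A = ∑ j, D.real (A ∩ {p | p.2 = j}) := (sum_measureReal_inter_label D A).symm
    _ ≤ ∑ j, b * D.real {p : 𝒳 × Fin k | p.2 = j} := Finset.sum_le_sum fun j _ =>
        (div_le_iff₀ (ENNReal.toReal_pos (hD j).ne' (measure_ne_top D _))).1 (hA j)
    _ = b := by rw [← Finset.mul_sum, hlabel, mul_one]

/-- The error given a label is at most the balanced error rate. -/
theorem condProb_le_BER {𝒳 : Type*} [MeasurableSpace 𝒳] {k : ℕ}
    (D : Measure (𝒳 × Fin k)) (f : 𝒳 → Fin k) (j : Fin k) :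
    condProb D {p | f p.1 ≠ p.2} j ≤ BER D f :=
  le_ciSup (f := fun j => condProb D {p | f p.1 ≠ p.2} j) (Set.finite_range _).bddAbove j

/-- Under generalized label shift, a classifier that factors through the feature map has the
same error given each label on both domains. -/
theorem GLS.condProb_error_eq {𝒳 Z : Type*} [MeasurableSpace 𝒳] [MeasurableSpace Z] {k : ℕ}
    {DS DT : Measure (𝒳 × Fin k)} {g : 𝒳 → Z} (hGLS : GLS DS DT g)
    {h : Z → Fin k} (hh : Measurable h) (j : Fin k) :
    condProb DS {p | (h ∘ g) p.1 ≠ p.2} j = condProb DT {p | (h ∘ g) p.1 ≠ p.2} j := by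
  have hset : {p : 𝒳 × Fin k | (h ∘ g) p.1 ≠ p.2} ∩ {p | p.2 = j} =
      {p | g p.1 ∈ h ⁻¹' {j}ᶜ} ∩ {p | p.2 = j} := by
    ext p
    simp only [Set.mem_inter_iff, Set.mem_ofPred_eq, Function.comp_apply, Set.mem_preimage,
      Set.mem_compl_iff, Set.mem_singleton_iff]
    exact and_congr_left fun hj => by rw [hj]
  have hfeature := hGLS j (h ⁻¹' {j}ᶜ) (hh (measurableSet_singleton j).compl)
  unfold condProb at hfeature ⊢
  rwa [hset]

/-- Under generalized label shift, the joint error is bounded by twice the balanced error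
rate on the source domain. -/
theorem joint_error_le_two_BER_of_GLS
    {𝒳 Z : Type*} [MeasurableSpace 𝒳] [MeasurableSpace Z] {k : ℕ} (hk : 2 ≤ k)
    (DS DT : Measure (𝒳 × Fin k)) [IsProbabilityMeasure DS] [IsProbabilityMeasure DT]
    (hS : ∀ j : Fin k, 0 < DS {p | p.2 = j}) (hT : ∀ j : Fin k, 0 < DT {p | p.2 = j})
    (g : 𝒳 → Z) (hg : Measurable g) (hGLS : GLS DS DT g)
    (h : Z → Fin k) (hh : Measurable h) :
    err DS (h ∘ g) + err DT (h ∘ g) ≤ 2 * BER DS (h ∘ g) := by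
  have hsource : err DS (h ∘ g) ≤ BER DS (h ∘ g) :=
    measureReal_le_of_condProb_le DS hS (condProb_le_BER DS (h ∘ g))
  have htarget : err DT (h ∘ g) ≤ BER DS (h ∘ g) :=
    measureReal_le_of_condProb_le DT hT fun j =>
      (hGLS.condProb_error_eq hh j).symm.trans_le (condProb_le_BER DS (h ∘ g) j)
  linarith
end

section
/- (Clustering structure implies sufficiency.) Let g : 𝒳 → 𝒵 be a measurable feature map such that D_T(Z ∈ E) = D_S^w(Z ∈ E) for every measurable E ⊆ 𝒵. Assume D_T(Y = y) > 0 for all y ∈ 𝒴. If there exists a measurable partition 𝒵 = ∪_{y∈𝒴} 𝒵_y such that for every y ∈ 𝒴, D_S(Z ∈ 𝒵_y | Y = y) = D_T(Z ∈ 𝒵_y | Y = y) = 1, then g satisfies generalized label shift (GLS), i.e., D_S(Z ∈ E | Y = y) = D_T(Z ∈ E | Y = y) for all y ∈ 𝒴 and all measurable E ⊆ 𝒵. -/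
open MeasureTheory Real
open scoped ENNReal

/-- Importance weights `w_y = D_T(Y = y) / D_S(Y = y)`. -/
noncomputable def iw {𝒳 : Type*} [MeasurableSpace 𝒳] {k : ℕ}
    (DS DT : Measure (𝒳 × Fin k)) (y : Fin k) : ℝ :=
  (DT {p | p.2 = y}).toReal / (DS {p | p.2 = y}).toReal

/-- If each class is supported on its own cell, almost every point has its feature in the cell of
its label. -/
theorem ae_mem_cell_of_condProb_eq_one {𝒳 Z : Type*} [MeasurableSpace 𝒳] [MeasurableSpace Z]
    {k : ℕ} {D : Measure (𝒳 × Fin k)} [IsFiniteMeasure D] {g : 𝒳 → Z} (hg : Measurable g)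
    {C : Fin k → Set Z} (hC : ∀ y, MeasurableSet (C y))
    (h : ∀ y, condProb D {p | g p.1 ∈ C y} y = 1) :
    ∀ᵐ p ∂D, g p.1 ∈ C p.2 := by
  have key : ∀ y, ∀ᵐ p ∂D, p.2 = y → g p.1 ∈ C y := by
    intro y
    have hm : MeasurableSet {p : 𝒳 × Fin k | g p.1 ∈ C y} := (hg.comp measurable_fst) (hC y)
    have hy := eq_of_div_eq_one (h y)
    rw [ENNReal.toReal_eq_toReal_iff' (measure_ne_top _ _) (measure_ne_top _ _)] at hy
    have hsplit := measure_inter_add_sdiff {p : 𝒳 × Fin k | p.2 = y} hm (μ := D)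
    rw [Set.inter_comm, hy] at hsplit
    have hzero : D ({p | p.2 = y} \ {p | g p.1 ∈ C y}) = 0 :=
      (ENNReal.add_right_inj (measure_ne_top D {p | p.2 = y})).1 (by rw [hsplit, add_zero])
    rw [ae_iff]
    convert hzero using 2
    ext p
    simp
  filter_upwards [ae_all_iff.2 key] with p hp using hp p.2 rfl

/-- When features lie in the cell of their label, restricting to a cell amounts to restricting to
the corresponding class. -/
theorem measure_feature_inter_cell {𝒳 Z : Type*} [MeasurableSpace 𝒳] {k : ℕ}
    {D : Measure (𝒳 × Fin k)} {g : 𝒳 → Z} {C : Fin k → Set Z}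
    (hdisj : Pairwise (Function.onFun Disjoint C)) (h : ∀ᵐ p ∂D, g p.1 ∈ C p.2)
    (E : Set Z) (y : Fin k) (A : Set (𝒳 × Fin k)) :
    D ({p | g p.1 ∈ E ∩ C y} ∩ A) = D ({p | g p.1 ∈ E} ∩ {p | p.2 = y} ∩ A) := by
  apply measure_congr
  filter_upwards [h] with p hp
  have hiff : g p.1 ∈ C y ↔ p.2 = y := by
    refine ⟨fun hy => ?_, fun hy => hy ▸ hp⟩
    by_contra hne
    exact Set.disjoint_left.1 (hdisj hne) hp hy
  apply propext
  change ((g p.1 ∈ E ∧ g p.1 ∈ C y) ∧ p ∈ A) ↔ ((g p.1 ∈ E ∧ p.2 = y) ∧ p ∈ A)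
  rw [hiff]

/-- Clustering structure implies sufficiency: if the target feature distribution equals the
`w`-reweighted source feature distribution and there is a measurable partition of the
feature space with each class supported on its own cell (in both domains), then `g`
satisfies generalized label shift. -/
theorem clustering_implies_GLS
    {𝒳 Z : Type*} [MeasurableSpace 𝒳] [MeasurableSpace Z] {k : ℕ} (hk : 2 ≤ k)
    (DS DT : Measure (𝒳 × Fin k)) [IsProbabilityMeasure DS] [IsProbabilityMeasure DT]
    (hS : ∀ y : Fin k, 0 < DS {p | p.2 = y}) (hT : ∀ y : Fin k, 0 < DT {p | p.2 = y})
    (g : 𝒳 → Z) (hg : Measurable g)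
    (hmatch : ∀ E : Set Z, MeasurableSet E →
      (DT {p | g p.1 ∈ E}).toReal =
        ∑ y : Fin k, iw DS DT y * (DS ({p | g p.1 ∈ E} ∩ {p | p.2 = y})).toReal)
    (C : Fin k → Set Z) (hC : ∀ y, MeasurableSet (C y))
    (hdisj : Pairwise (Function.onFun Disjoint C)) (hcover : ⋃ y, C y = Set.univ)
    (hclust : ∀ y : Fin k,
      condProb DS {p | g p.1 ∈ C y} y = 1 ∧ condProb DT {p | g p.1 ∈ C y} y = 1) :
    GLS DS DT g := by
  intro y E hE
  have haeS := ae_mem_cell_of_condProb_eq_one hg hC fun y => (hclust y).1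
  have haeT := ae_mem_cell_of_condProb_eq_one hg hC fun y => (hclust y).2
  have hm := hmatch (E ∩ C y) (hE.inter (hC y))
  have hT' := measure_feature_inter_cell hdisj haeT E y Set.univ
  rw [Set.inter_univ, Set.inter_univ] at hT'
  rw [hT', Finset.sum_eq_single y] at hm
  · rw [measure_feature_inter_cell hdisj haeS, Set.inter_assoc, Set.inter_self] at hm
    have hTy : (DT {p | p.2 = y}).toReal ≠ 0 :=
      (ENNReal.toReal_pos (hT y).ne' (measure_ne_top _ _)).ne'
    have hSy : (DS {p | p.2 = y}).toReal ≠ 0 :=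
      (ENNReal.toReal_pos (hS y).ne' (measure_ne_top _ _)).ne'
    unfold condProb
    rw [hm, iw]
    field_simp
  · intro y' _ hne
    rw [measure_feature_inter_cell hdisj haeS]
    have hempty : ({p : 𝒳 × Fin k | g p.1 ∈ E} ∩ {p | p.2 = y} ∩ {p | p.2 = y'}) = ∅ := by
      ext p
      simp only [Set.mem_inter_iff, Set.mem_ofPred_eq, Set.mem_empty_iff_false, iff_false]
      rintro ⟨⟨_, h₁⟩, h₂⟩
      exact hne (h₂.symm.trans h₁)
    simp [hempty]
  · simp
end

section
/- Let g : 𝒳 → 𝒵 be a measurable feature map and h : 𝒵 → 𝒴 measurable, with Ŷ = h(g(X)). Let γ := min_{y∈𝒴} D_T(Y = y) > 0 and w_M := max_{y∈𝒴} w_y. Then for every y ∈ 𝒴 and every measurable set E ⊆ 𝒵: |D_S(Z ∈ E | Y = y) − D_T(Z ∈ E | Y = y)| ≤ (w_M·ε_S(Ŷ) + ε_T(Ŷ) + d_TV(D_S^w(Z), D_T(Z))) / γ. -/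
open MeasureTheory Real
open scoped ENNReal

/-- Total variation distance: supremum over measurable sets of the absolute difference. -/
noncomputable def tvDist {Ω : Type*} [MeasurableSpace Ω] (μ ν : Measure Ω) : ℝ :=
  ⨆ E : {s : Set Ω // MeasurableSet s}, |(μ E.1).toReal - (ν E.1).toReal|

/-- The feature distribution: pushforward of the input marginal by `g`. -/
noncomputable def featMeasure {𝒳 Z : Type*} [MeasurableSpace 𝒳] [MeasurableSpace Z] {k : ℕ}
    (D : Measure (𝒳 × Fin k)) (g : 𝒳 → Z) : Measure Z :=
  D.map fun p => g p.1

/-- The `w`-reweighted source feature distribution `D_S^w(Z ∈ E) = Σ_y w_y·D_S(Z ∈ E, Y = y)`. -/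
noncomputable def reweightedFeat {𝒳 Z : Type*} [MeasurableSpace 𝒳] [MeasurableSpace Z] {k : ℕ}
    (DS DT : Measure (𝒳 × Fin k)) (g : 𝒳 → Z) : Measure Z :=
  ∑ y : Fin k,
    ENNReal.ofReal (iw DS DT y) • ((DS.restrict {p | p.2 = y}).map fun p => g p.1)

/-- A difference of masses of finite measures is at most their total variation distance. -/
theorem abs_sub_le_tvDist {Ω : Type*} [MeasurableSpace Ω] (μ ν : Measure Ω)
    [IsFiniteMeasure μ] [IsFiniteMeasure ν] {E : Set Ω} (hE : MeasurableSet E) :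
    |μ.real E - ν.real E| ≤ tvDist μ ν := by
  refine le_ciSup (f := fun E : {s : Set Ω // MeasurableSet s} =>
    |(μ E.1).toReal - (ν E.1).toReal|) ⟨μ.real Set.univ + ν.real Set.univ, ?_⟩ ⟨E, hE⟩
  rintro _ ⟨F, rfl⟩
  change |μ.real F.1 - ν.real F.1| ≤ _
  have hμ : μ.real F.1 ≤ μ.real Set.univ := measureReal_mono (Set.subset_univ _)
  have hν : ν.real F.1 ≤ ν.real Set.univ := measureReal_mono (Set.subset_univ _)
  have hμ₀ : 0 ≤ μ.real F.1 := measureReal_nonneg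
  have hν₀ : 0 ≤ ν.real F.1 := measureReal_nonneg
  rw [abs_le]
  constructor <;> linarith

theorem measurableSet_snd_eq {𝒳 : Type*} [MeasurableSpace 𝒳] {k : ℕ} (y : Fin k) :
    MeasurableSet {p : 𝒳 × Fin k | p.2 = y} :=
  measurable_snd (measurableSet_singleton y)

theorem sum_measureReal_inter_snd_eq {𝒳 : Type*} [MeasurableSpace 𝒳] {k : ℕ}
    (D : Measure (𝒳 × Fin k)) [IsFiniteMeasure D] {A : Set (𝒳 × Fin k)} (hA : MeasurableSet A) :
    ∑ y : Fin k, D.real (A ∩ {p | p.2 = y}) = D.real A := by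
  rw [← measureReal_biUnion_finset]
  · congr 1
    ext p
    simp
  · intro i _ j _ hij
    refine Set.disjoint_left.2 fun p hp hq => hij ?_
    exact hp.2.symm.trans hq.2
  · exact fun y _ => hA.inter (measurableSet_snd_eq y)

theorem iw_nonneg {𝒳 : Type*} [MeasurableSpace 𝒳] {k : ℕ}
    (DS DT : Measure (𝒳 × Fin k)) (y : Fin k) : 0 ≤ iw DS DT y :=
  div_nonneg ENNReal.toReal_nonneg ENNReal.toReal_nonneg

instance isFiniteMeasure_reweightedFeat {𝒳 Z : Type*} [MeasurableSpace 𝒳] [MeasurableSpace Z]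
    {k : ℕ} (DS DT : Measure (𝒳 × Fin k)) [IsFiniteMeasure DS] (g : 𝒳 → Z) :
    IsFiniteMeasure (reweightedFeat DS DT g) := by
  refine ⟨?_⟩
  rw [reweightedFeat, Measure.finsetSum_apply]
  refine ENNReal.sum_lt_top.2 fun y _ => ?_
  rw [Measure.smul_apply, smul_eq_mul]
  exact ENNReal.mul_lt_top ENNReal.ofReal_lt_top (measure_lt_top _ _)

theorem reweightedFeat_real_apply {𝒳 Z : Type*} [MeasurableSpace 𝒳] [MeasurableSpace Z]
    {k : ℕ} (DS DT : Measure (𝒳 × Fin k)) [IsFiniteMeasure DS] {g : 𝒳 → Z} (hg : Measurable g)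
    {E : Set Z} (hE : MeasurableSet E) :
    (reweightedFeat DS DT g).real E =
      ∑ y : Fin k, iw DS DT y * DS.real ({p | g p.1 ∈ E} ∩ {p | p.2 = y}) := by
  have hgm : Measurable fun p : 𝒳 × Fin k => g p.1 := hg.comp measurable_fst
  rw [Measure.real, reweightedFeat, Measure.finsetSum_apply, ENNReal.toReal_sum]
  · refine Finset.sum_congr rfl fun y _ => ?_
    rw [Measure.smul_apply, smul_eq_mul, ENNReal.toReal_mul,
      ENNReal.toReal_ofReal (iw_nonneg DS DT y), Measure.map_apply hgm hE,
      Measure.restrict_apply (hgm hE)]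
    rfl
  · intro y _
    rw [Measure.smul_apply, smul_eq_mul]
    exact ENNReal.mul_ne_top ENNReal.ofReal_ne_top (measure_ne_top _ _)

/-- The gap between the reweighted source and target joint masses of `Z ∈ E` and `Y = y`. -/
theorem abs_iw_mul_sub_le {𝒳 Z : Type*} [MeasurableSpace 𝒳] [MeasurableSpace Z] {k : ℕ}
    (DS DT : Measure (𝒳 × Fin k)) [IsFiniteMeasure DS] [IsFiniteMeasure DT]
    {g : 𝒳 → Z} (hg : Measurable g) {h : Z → Fin k} (hh : Measurable h)
    (y : Fin k) {E : Set Z} (hE : MeasurableSet E) :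
    |iw DS DT y * DS.real ({p | g p.1 ∈ E} ∩ {p | p.2 = y}) -
        DT.real ({p | g p.1 ∈ E} ∩ {p | p.2 = y})| ≤
      (⨆ y' : Fin k, iw DS DT y') * err DS (h ∘ g) + err DT (h ∘ g) +
        tvDist (reweightedFeat DS DT g) (featMeasure DT g) := by
  have hgm : Measurable fun p : 𝒳 × Fin k => g p.1 := hg.comp measurable_fst
  have hF : MeasurableSet (E ∩ h ⁻¹' {y}) := hE.inter (hh (measurableSet_singleton y))
  set A : Set (𝒳 × Fin k) := {p | g p.1 ∈ E ∩ h ⁻¹' {y}} with hA_def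
  have hA : MeasurableSet A := hgm hF
  have : IsFiniteMeasure (featMeasure DT g) := by unfold featMeasure; infer_instance
  have htv := abs_sub_le_tvDist (reweightedFeat DS DT g) (featMeasure DT g) hF
  have hfeat : (featMeasure DT g).real (E ∩ h ⁻¹' {y}) = DT.real A := by
    rw [Measure.real, featMeasure, Measure.map_apply hgm hF]
    rfl
  rw [reweightedFeat_real_apply DS DT hg hF, hfeat, ← hA_def, abs_le] at htv
  have hle : ∀ j, iw DS DT j ≤ ⨆ j', iw DS DT j' := le_ciSup (Set.finite_range _).bddAbove
  have split : ∀ D : Measure (𝒳 × Fin k), IsFiniteMeasure D →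
      ∃ b, 0 ≤ b ∧ b ≤ err D (h ∘ g) ∧
        D.real ({p | g p.1 ∈ E} ∩ {p | p.2 = y}) = D.real (A ∩ {p | p.2 = y}) + b := by
    intro D _
    refine ⟨D.real (({p | g p.1 ∈ E} ∩ {p | p.2 = y}) \ A), measureReal_nonneg,
      measureReal_mono ?_, ?_⟩
    · rintro p ⟨⟨hp, rfl⟩, hpA⟩ heq
      exact hpA ⟨hp, heq⟩
    · rw [← measureReal_inter_add_sdiff hA]
      congr 2
      ext p
      simp only [hA_def, Set.mem_inter_iff, Set.mem_ofPred_eq]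
      tauto
  have miss : ∀ D : Measure (𝒳 × Fin k), IsFiniteMeasure D →
      D.real A - D.real (A ∩ {p | p.2 = y}) ≤ err D (h ∘ g) := by
    intro D _
    have hd := measureReal_inter_add_sdiff (μ := D) (s := A) (measurableSet_snd_eq y)
    have hm : D.real (A \ {p | p.2 = y}) ≤ err D (h ∘ g) := by
      refine measureReal_mono ?_
      rintro p ⟨⟨_, hp⟩, hpy⟩ heq
      exact hpy (heq.symm.trans hp)
    linarith
  obtain ⟨bS, hbS₀, hbS, hS⟩ := split DS inferInstance
  obtain ⟨bT, hbT₀, hbT, hT⟩ := split DT inferInstance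
  have hmS := miss DS inferInstance
  have hmT := miss DT inferInstance
  have hAT : DT.real (A ∩ {p | p.2 = y}) ≤ DT.real A := measureReal_mono Set.inter_subset_left
  have hsum := sum_measureReal_inter_snd_eq DS hA
  rw [← Finset.add_sum_erase _ _ (Finset.mem_univ y)] at htv hsum
  have hw₀ : 0 ≤ ⨆ j', iw DS DT j' := (iw_nonneg DS DT y).trans (hle y)
  have hc₀ : 0 ≤ ∑ j ∈ Finset.univ.erase y, iw DS DT j * DS.real (A ∩ {p | p.2 = j}) :=
    Finset.sum_nonneg fun j _ => mul_nonneg (iw_nonneg DS DT j) measureReal_nonneg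
  have hc : ∑ j ∈ Finset.univ.erase y, iw DS DT j * DS.real (A ∩ {p | p.2 = j}) ≤
      (⨆ j', iw DS DT j') * err DS (h ∘ g) := by
    calc _ ≤ ∑ j ∈ Finset.univ.erase y, (⨆ j', iw DS DT j') * DS.real (A ∩ {p | p.2 = j}) :=
          Finset.sum_le_sum fun j _ => mul_le_mul_of_nonneg_right (hle j) measureReal_nonneg
      _ = (⨆ j', iw DS DT j') * ∑ j ∈ Finset.univ.erase y, DS.real (A ∩ {p | p.2 = j}) :=
          (Finset.mul_sum _ _ _).symm
      _ ≤ _ := mul_le_mul_of_nonneg_left (by linarith) hw₀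
  have hb₀ : 0 ≤ iw DS DT y * bS := mul_nonneg (iw_nonneg DS DT y) hbS₀
  have hb : iw DS DT y * bS ≤ (⨆ j', iw DS DT j') * err DS (h ∘ g) :=
    mul_le_mul (hle y) hbS hbS₀ hw₀
  rw [hS, hT, mul_add, abs_le]
  constructor <;> linarith [htv.1, htv.2]

/-- Pointwise bound on the conditional feature-distribution gap in terms of the errors and the
total variation distance between the reweighted source and target feature distributions. -/
theorem conditional_gap_bound_tv
    {𝒳 Z : Type*} [MeasurableSpace 𝒳] [MeasurableSpace Z] {k : ℕ} (hk : 2 ≤ k)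
    (DS DT : Measure (𝒳 × Fin k)) [IsProbabilityMeasure DS] [IsProbabilityMeasure DT]
    (hS : ∀ y : Fin k, 0 < DS {p | p.2 = y}) (hT : ∀ y : Fin k, 0 < DT {p | p.2 = y})
    (g : 𝒳 → Z) (hg : Measurable g) (h : Z → Fin k) (hh : Measurable h) :
    ∀ y : Fin k, ∀ E : Set Z, MeasurableSet E →
      |condProb DS {p | g p.1 ∈ E} y - condProb DT {p | g p.1 ∈ E} y| ≤
        ((⨆ y' : Fin k, iw DS DT y') * err DS (h ∘ g) + err DT (h ∘ g) +
            tvDist (reweightedFeat DS DT g) (featMeasure DT g)) /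
          (⨅ y' : Fin k, (DT {p | p.2 = y'}).toReal) := by
  intro y E hE
  have hgap := abs_iw_mul_sub_le DS DT hg hh y hE
  have hSy : 0 < DS.real {p | p.2 = y} := ENNReal.toReal_pos (hS y).ne' (measure_ne_top _ _)
  have hTy : ∀ j, 0 < DT.real {p | p.2 = j} := fun j =>
    ENNReal.toReal_pos (hT j).ne' (measure_ne_top _ _)
  have : Nonempty (Fin k) := ⟨y⟩
  have hmin : 0 < ⨅ j : Fin k, (DT {p | p.2 = j}).toReal := by
    obtain ⟨j, hj⟩ := exists_eq_ciInf_of_finite (f := fun j : Fin k => (DT {p | p.2 = j}).toReal)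
    rw [← hj]
    exact hTy j
  have hle : (⨅ j : Fin k, (DT {p | p.2 = j}).toReal) ≤ DT.real {p | p.2 = y} :=
    ciInf_le (Set.finite_range _).bddBelow y
  have hcond : condProb DS {p | g p.1 ∈ E} y - condProb DT {p | g p.1 ∈ E} y =
      (iw DS DT y * DS.real ({p | g p.1 ∈ E} ∩ {p | p.2 = y}) -
        DT.real ({p | g p.1 ∈ E} ∩ {p | p.2 = y})) / DT.real {p | p.2 = y} := by
    have hSy' := hSy.ne'
    have hTy' := (hTy y).ne'
    simp only [condProb, iw, ← measureReal_def]
    field_simp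
  rw [hcond, abs_div, abs_of_pos (hTy y)]
  exact div_le_div₀ ((abs_nonneg _).trans hgap) hgap hmin hle
end

section
/- If the measurable feature map g : 𝒳 → 𝒵 satisfies generalized label shift (GLS) and Ŷ = h(g(X)) for a measurable h : 𝒵 → 𝒴, then the prediction marginal on the target domain equals the confusion matrix applied to the importance weights: for every y ∈ 𝒴, μ_y = Σ_{y'∈𝒴} C_{y,y'} · w_{y'}. In particular, if the confusion matrix C is invertible then w = C⁻¹μ. -/
open MeasureTheory Real
open scoped ENNReal

/-- Confusion matrix of the classifier `f` on the source domain: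
`C_{y,y'} = D_S(Ŷ = y, Y = y')`. -/
noncomputable def confusion {𝒳 : Type*} [MeasurableSpace 𝒳] {k : ℕ}
    (DS : Measure (𝒳 × Fin k)) (f : 𝒳 → Fin k) : Matrix (Fin k) (Fin k) ℝ :=
  Matrix.of fun y y' => (DS ({p | f p.1 = y} ∩ {p | p.2 = y'})).toReal

/-- Distribution of predictions of the classifier `f` on the target domain:
`μ_y = D_T(Ŷ = y)`. -/
noncomputable def predMarginal {𝒳 : Type*} [MeasurableSpace 𝒳] {k : ℕ}
    (DT : Measure (𝒳 × Fin k)) (f : 𝒳 → Fin k) : Fin k → ℝ :=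
  fun y => (DT {p | f p.1 = y}).toReal

/-- Joint target probabilities of feature events and labels are the corresponding source
probabilities reweighted by the importance weights. -/
theorem GLS.measure_inter_eq_mul_iw {𝒳 Z : Type*} [MeasurableSpace 𝒳] [MeasurableSpace Z] {k : ℕ}
    {DS DT : Measure (𝒳 × Fin k)} [IsFiniteMeasure DT] {g : 𝒳 → Z} (hGLS : GLS DS DT g)
    {E : Set Z} (hE : MeasurableSet E) (y : Fin k) :
    (DT ({p | g p.1 ∈ E} ∩ {p | p.2 = y})).toReal =
      (DS ({p | g p.1 ∈ E} ∩ {p | p.2 = y})).toReal * iw DS DT y := by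
  have hle : (DT ({p | g p.1 ∈ E} ∩ {p | p.2 = y})).toReal ≤ (DT {p | p.2 = y}).toReal :=
    ENNReal.toReal_mono (measure_ne_top _ _) (measure_mono Set.inter_subset_right)
  have hcond := hGLS y E hE
  unfold condProb at hcond
  rw [iw, mul_div_left_comm, hcond]
  refine (mul_div_cancel_of_imp' fun h0 => ?_).symm
  exact le_antisymm (h0 ▸ hle) ENNReal.toReal_nonneg

/-- The law of total probability over the label. -/
theorem toReal_measure_eq_sum_inter_label {𝒳 : Type*} [MeasurableSpace 𝒳] {k : ℕ}
    (D : Measure (𝒳 × Fin k)) [IsFiniteMeasure D] (A : Set (𝒳 × Fin k)) :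
    (D A).toReal = ∑ y : Fin k, (D (A ∩ {p | p.2 = y})).toReal := by
  have hsum := sum_measureReal_preimage_singleton (μ := D.restrict A) (f := Prod.snd)
    Finset.univ fun y _ => measurable_snd (measurableSet_singleton y)
  simp only [Finset.coe_univ, Set.preimage_univ, measureReal_restrict_apply_univ] at hsum
  rw [← measureReal_def, ← hsum]
  refine Finset.sum_congr rfl fun y _ => ?_
  rw [measureReal_restrict_apply (measurable_snd (measurableSet_singleton y)), Set.inter_comm]
  rfl

/-- Under GLS, the prediction marginal on the target equals the confusion matrix applied to
the importance weights: `μ = C·w`; in particular if `C` is invertible then `w = C⁻¹·μ`. -/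
theorem gls_weight_estimation
    {𝒳 Z : Type*} [MeasurableSpace 𝒳] [MeasurableSpace Z] {k : ℕ} (hk : 2 ≤ k)
    (DS DT : Measure (𝒳 × Fin k)) [IsProbabilityMeasure DS] [IsProbabilityMeasure DT]
    (hS : ∀ y : Fin k, 0 < DS {p | p.2 = y})
    (g : 𝒳 → Z) (hg : Measurable g) (hGLS : GLS DS DT g)
    (h : Z → Fin k) (hh : Measurable h) :
    (∀ y : Fin k, predMarginal DT (h ∘ g) y =
      ∑ y' : Fin k, confusion DS (h ∘ g) y y' * iw DS DT y') ∧
    (IsUnit (confusion DS (h ∘ g)).det →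
      (confusion DS (h ∘ g))⁻¹.mulVec (predMarginal DT (h ∘ g)) = iw DS DT) := by
  have hμ : ∀ y : Fin k, predMarginal DT (h ∘ g) y =
      ∑ y' : Fin k, confusion DS (h ∘ g) y y' * iw DS DT y' := fun y =>
    (toReal_measure_eq_sum_inter_label DT _).trans <| Finset.sum_congr rfl fun y' _ =>
      hGLS.measure_inter_eq_mul_iw (hh (measurableSet_singleton y)) y'
  refine ⟨hμ, fun hdet => ?_⟩
  have hmul : predMarginal DT (h ∘ g) = (confusion DS (h ∘ g)).mulVec (iw DS DT) := funext hμ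
  rw [hmul, Matrix.mulVec_mulVec, Matrix.nonsing_inv_mul _ hdet, Matrix.one_mulVec]
end

section
/- Let g : 𝒳 → 𝒵 and h : 𝒵 → 𝒴 be measurable, Ŷ = h(g(X)), and let w̃ : 𝒴 → ℝ≥0 satisfy Σ_{y} w̃_y·D_S(Y = y) = 1 (so D_S^w̃(Z) is a probability measure). If the source error is zero, ε_S(h∘g) = 0, and D_JS(D_S^w̃(Z) ‖ D_T(Z)) = 0, then for every y ∈ 𝒴, μ_y = w̃_y · D_S(Y = y); equivalently, since the confusion matrix C is then diagonal with diagonal entries D_S(Y = y) > 0, the estimated weight vector w = C⁻¹μ equals w̃. -/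
open MeasureTheory Real
open scoped ENNReal

/-- The `w̃`-reweighted source feature distribution
`D_S^w̃(Z ∈ E) = Σ_y w̃_y·D_S(Z ∈ E, Y = y)` for a weight function `w̃ : 𝒴 → ℝ`. -/
noncomputable def reweightedFeatW {𝒳 Z : Type*} [MeasurableSpace 𝒳] [MeasurableSpace Z] {k : ℕ}
    (DS : Measure (𝒳 × Fin k)) (g : 𝒳 → Z) (wt : Fin k → ℝ) : Measure Z :=
  ∑ y : Fin k, ENNReal.ofReal (wt y) • ((DS.restrict {p | p.2 = y}).map fun p => g p.1)

/-- A finite measure is absolutely continuous, with integrable log-likelihood ratio, with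
respect to its midpoint with any finite measure: the density is bounded by `2`. -/
theorem integrable_llr_midpoint {Ω : Type*} [MeasurableSpace Ω] (μ ν : Measure Ω)
    [IsFiniteMeasure μ] [IsFiniteMeasure ν] :
    μ ≪ (2 : ℝ≥0∞)⁻¹ • (μ + ν) ∧ Integrable (llr μ ((2 : ℝ≥0∞)⁻¹ • (μ + ν))) μ := by
  have hfin : IsFiniteMeasure ((2 : ℝ≥0∞)⁻¹ • (μ + ν)) := Measure.smul_finite _ (by simp)
  have hac' : (μ + ν) ≪ (2 : ℝ≥0∞)⁻¹ • (μ + ν) :=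
    Measure.absolutelyContinuous_smul (by simp)
  have hac : μ ≪ (2 : ℝ≥0∞)⁻¹ • (μ + ν) :=
    (Measure.absolutelyContinuous_of_le (Measure.le_add_right le_rfl)).trans hac'
  refine ⟨hac, (integrable_rnDeriv_mul_log_iff hac).mp ?_⟩
  have hbound : ∀ᵐ x ∂((2 : ℝ≥0∞)⁻¹ • (μ + ν)),
      ((μ.rnDeriv ((2 : ℝ≥0∞)⁻¹ • (μ + ν))) x).toReal ∈ Set.Icc (0 : ℝ) 2 := by
    have h1 : ∀ᵐ x ∂(μ + ν), (μ.rnDeriv (μ + ν)) x ≤ 1 :=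
      Measure.rnDeriv_le_one_of_le (Measure.le_add_right le_rfl)
    have h2 := Measure.rnDeriv_smul_right_of_ne_top μ (μ + ν)
      (r := (2 : ℝ≥0∞)⁻¹) (by simp) (by simp)
    refine Measure.ae_smul_measure ?_ _
    filter_upwards [h1, h2] with x hx1 hx2
    refine ⟨ENNReal.toReal_nonneg, ?_⟩
    rw [hx2]
    refine ENNReal.toReal_le_of_le_ofReal (by norm_num) ?_
    simpa using mul_le_mul_right hx1 2
  obtain ⟨c, hc⟩ := (isCompact_Icc (a := (0 : ℝ)) (b := 2)).exists_bound_of_continuousOn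
    Real.continuous_mul_log.continuousOn
  refine Integrable.of_bound (C := c) ?_ ?_
  · have := Measure.measurable_rnDeriv μ ((2 : ℝ≥0∞)⁻¹ • (μ + ν))
    exact (by fun_prop : Measurable _).aestronglyMeasurable
  · filter_upwards [hbound] with x hx using hc _ hx

theorem isProbabilityMeasure_midpoint {Ω : Type*} [MeasurableSpace Ω] (μ ν : Measure Ω)
    [IsProbabilityMeasure μ] [IsProbabilityMeasure ν] :
    IsProbabilityMeasure ((2 : ℝ≥0∞)⁻¹ • (μ + ν)) := by
  constructor
  simp [ENNReal.inv_two_add_inv_two]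

theorem klDiv_midpoint_eq_toReal {Ω : Type*} [MeasurableSpace Ω] (μ ν : Measure Ω)
    [IsProbabilityMeasure μ] [IsProbabilityMeasure ν] :
    klDiv μ ((2 : ℝ≥0∞)⁻¹ • (μ + ν)) =
      (InformationTheory.klDiv μ ((2 : ℝ≥0∞)⁻¹ • (μ + ν))).toReal := by
  have := isProbabilityMeasure_midpoint μ ν
  rw [InformationTheory.toReal_klDiv_of_measure_eq (integrable_llr_midpoint μ ν).1
    (by rw [measure_univ, measure_univ])]
  rfl

theorem eq_midpoint_of_klDiv_eq_zero {Ω : Type*} [MeasurableSpace Ω] (μ ν : Measure Ω)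
    [IsProbabilityMeasure μ] [IsProbabilityMeasure ν]
    (h : klDiv μ ((2 : ℝ≥0∞)⁻¹ • (μ + ν)) = 0) : μ = (2 : ℝ≥0∞)⁻¹ • (μ + ν) := by
  have := isProbabilityMeasure_midpoint μ ν
  obtain ⟨hac, hint⟩ := integrable_llr_midpoint μ ν
  rw [klDiv_midpoint_eq_toReal, ENNReal.toReal_eq_zero_iff] at h
  exact InformationTheory.klDiv_eq_zero_iff.mp
    (h.resolve_right (InformationTheory.klDiv_ne_top hac hint))

theorem eq_of_jsDiv_eq_zero {Ω : Type*} [MeasurableSpace Ω] (μ ν : Measure Ω)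
    [IsProbabilityMeasure μ] [IsProbabilityMeasure ν] (h : jsDiv μ ν = 0) : μ = ν := by
  have hμ : 0 ≤ klDiv μ ((2 : ℝ≥0∞)⁻¹ • (μ + ν)) := by
    rw [klDiv_midpoint_eq_toReal]; exact ENNReal.toReal_nonneg
  have hν : 0 ≤ klDiv ν ((2 : ℝ≥0∞)⁻¹ • (μ + ν)) := by
    rw [add_comm μ ν, klDiv_midpoint_eq_toReal]; exact ENNReal.toReal_nonneg
  unfold jsDiv at h
  have hμ0 : klDiv μ ((2 : ℝ≥0∞)⁻¹ • (μ + ν)) = 0 := by linarith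
  have hν0 : klDiv ν ((2 : ℝ≥0∞)⁻¹ • (ν + μ)) = 0 := by rw [add_comm ν μ]; linarith
  rw [eq_midpoint_of_klDiv_eq_zero μ ν hμ0, add_comm μ ν]
  exact (eq_midpoint_of_klDiv_eq_zero ν μ hν0).symm

theorem reweightedFeatW_apply {𝒳 Z : Type*} [MeasurableSpace 𝒳] [MeasurableSpace Z] {k : ℕ}
    (DS : Measure (𝒳 × Fin k)) {g : 𝒳 → Z} (hg : Measurable g) (wt : Fin k → ℝ)
    {E : Set Z} (hE : MeasurableSet E) :
    reweightedFeatW DS g wt E =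
      ∑ y : Fin k, ENNReal.ofReal (wt y) * DS ({p | g p.1 ∈ E} ∩ {p | p.2 = y}) := by
  have hg' : Measurable fun p : 𝒳 × Fin k => g p.1 := hg.comp measurable_fst
  simp only [reweightedFeatW, Measure.finsetSum_apply, Measure.smul_apply, smul_eq_mul]
  refine Finset.sum_congr rfl fun y _ => ?_
  rw [Measure.map_apply hg' hE, Measure.restrict_apply (hg' hE)]
  rfl

theorem isProbabilityMeasure_reweightedFeatW {𝒳 Z : Type*} [MeasurableSpace 𝒳]
    [MeasurableSpace Z] {k : ℕ} (DS : Measure (𝒳 × Fin k)) [IsFiniteMeasure DS]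
    {g : 𝒳 → Z} (hg : Measurable g) {wt : Fin k → ℝ} (hwt0 : ∀ y, 0 ≤ wt y)
    (hwt1 : ∑ y : Fin k, wt y * (DS {p | p.2 = y}).toReal = 1) :
    IsProbabilityMeasure (reweightedFeatW DS g wt) := by
  constructor
  rw [reweightedFeatW_apply DS hg wt MeasurableSet.univ, ← ENNReal.ofReal_one, ← hwt1,
    ENNReal.ofReal_sum_of_nonneg fun y _ => mul_nonneg (hwt0 y) ENNReal.toReal_nonneg]
  refine Finset.sum_congr rfl fun y _ => ?_
  rw [ENNReal.ofReal_mul (hwt0 y), ENNReal.ofReal_toReal (measure_ne_top _ _)]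
  simp

/-- With zero error, the joint law of prediction and label is concentrated on the diagonal. -/
theorem measure_prediction_inter_label {𝒳 : Type*} [MeasurableSpace 𝒳] {k : ℕ}
    (DS : Measure (𝒳 × Fin k)) {f : 𝒳 → Fin k} (herr : DS {p | f p.1 ≠ p.2} = 0)
    (y y' : Fin k) :
    DS ({p | f p.1 = y} ∩ {p | p.2 = y'}) = if y' = y then DS {p | p.2 = y} else 0 := by
  split_ifs with hy
  · subst hy
    refine measure_congr ?_
    have hae : ∀ᵐ p ∂DS, f p.1 = p.2 := herr
    filter_upwards [hae] with p hp
    refine propext ⟨fun h => h.2, fun h => ⟨hp.trans h, h⟩⟩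
  · refine measure_mono_null ?_ herr
    rintro p ⟨h1, h2⟩ h3
    exact hy (h2.symm.trans (h3.symm.trans h1))

/-- If the source error is zero and the `w̃`-reweighted source feature distribution matches
the target feature distribution (zero JSD), then `μ_y = w̃_y·D_S(Y = y)`; equivalently the
estimated weight vector `C⁻¹μ` equals `w̃`. -/
theorem weight_estimation_stability
    {𝒳 Z : Type*} [MeasurableSpace 𝒳] [MeasurableSpace Z] {k : ℕ} (hk : 2 ≤ k)
    (DS DT : Measure (𝒳 × Fin k)) [IsProbabilityMeasure DS] [IsProbabilityMeasure DT]
    (hS : ∀ y : Fin k, 0 < DS {p | p.2 = y})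
    (g : 𝒳 → Z) (hg : Measurable g) (h : Z → Fin k) (hh : Measurable h)
    (wt : Fin k → ℝ) (hwt0 : ∀ y, 0 ≤ wt y)
    (hwt1 : ∑ y : Fin k, wt y * (DS {p | p.2 = y}).toReal = 1)
    (herrS : DS {p | h (g p.1) ≠ p.2} = 0)
    (hjs : jsDiv (reweightedFeatW DS g wt) (featMeasure DT g) = 0) :
    (∀ y : Fin k, predMarginal DT (h ∘ g) y = wt y * (DS {p | p.2 = y}).toReal) ∧
    (confusion DS (h ∘ g))⁻¹.mulVec (predMarginal DT (h ∘ g)) = wt := by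
  have herr : DS {p | (h ∘ g) p.1 ≠ p.2} = 0 := herrS
  have hpred : ∀ y, predMarginal DT (h ∘ g) y = wt y * (DS {p | p.2 = y}).toReal := by
    intro y
    have hg' : Measurable fun p : 𝒳 × Fin k => g p.1 := hg.comp measurable_fst
    have := isProbabilityMeasure_reweightedFeatW DS hg hwt0 hwt1
    have : IsProbabilityMeasure (featMeasure DT g) :=
      Measure.isProbabilityMeasure_map hg'.aemeasurable
    have hE : MeasurableSet (h ⁻¹' {y}) := hh (measurableSet_singleton y)
    have key : DT {p | (h ∘ g) p.1 = y} = reweightedFeatW DS g wt (h ⁻¹' {y}) := by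
      rw [eq_of_jsDiv_eq_zero _ _ hjs, featMeasure, Measure.map_apply hg' hE]
      rfl
    have hinter (y' : Fin k) : DS ({p | g p.1 ∈ h ⁻¹' {y}} ∩ {p | p.2 = y'}) =
        if y' = y then DS {p | p.2 = y} else 0 :=
      measure_prediction_inter_label DS herr y y'
    rw [predMarginal, key, reweightedFeatW_apply DS hg wt hE]
    simp only [hinter, mul_ite, mul_zero, Finset.sum_ite_eq', Finset.mem_univ,
      if_true, ENNReal.toReal_mul, ENNReal.toReal_ofReal (hwt0 y)]
  refine ⟨hpred, ?_⟩
  have hC : confusion DS (h ∘ g) = Matrix.diagonal fun y => (DS {p | p.2 = y}).toReal := by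
    ext y y'
    rw [confusion, Matrix.of_apply, measure_prediction_inter_label DS herr,
      Matrix.diagonal_apply, apply_ite ENNReal.toReal, ENNReal.toReal_zero]
    simp only [eq_comm]
  have hdet : IsUnit (confusion DS (h ∘ g)).det := by
    rw [hC, Matrix.det_diagonal, isUnit_iff_ne_zero, Finset.prod_ne_zero_iff]
    exact fun y _ => (ENNReal.toReal_pos (hS y).ne' (measure_ne_top _ _)).ne'
  have hmul : (confusion DS (h ∘ g)).mulVec wt = predMarginal DT (h ∘ g) := by
    ext y
    rw [hC, Matrix.mulVec_diagonal, hpred, mul_comm]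
  rw [← hmul, Matrix.mulVec_mulVec, Matrix.nonsing_inv_mul _ hdet, Matrix.one_mulVec]
end
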